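/- Suppose every type I 6-cycle in the D_4 Artin complex satisfies property (*). Let x_0 be a left coset of A_b̂, let x_1, x_3 be distinct left cosets of A_â, and let x_2, x_4 be distinct left cosets of A_ĉ, with x_0 ∩ x_1, x_1 ∩ x_2, x_2 ∩ x_3, x_3 ∩ x_4 and x_4 ∩ x_0 all nonempty (an embedded 5-cycle). Then either x_4 ∩ x_1 ≠ ∅, or x_0 ∩ x_2 ≠ ∅ and x_0 ∩ x_3 ≠ ∅ (so that x_0 is adjacent to each of x_1, x_2, x_3, x_4). -/

import Mathlib

/-!
The Artin group of type `D₄`, with generators `a, b, c, d`, where `d` is the central node of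
the Dynkin diagram: relations `ada = dad`, `bdb = dbd`, `cdc = dcd`, `ab = ba`, `ac = ca`,
`bc = cb`.
-/

open Pointwise

namespace D4Artin

/-- The generators of the `D₄` Artin group. -/
inductive Gen : Type
  | a | b | c | d
deriving DecidableEq

open Gen

/-- The defining relators of the `D₄` Artin group: a braid relation `sts = tst` whenever one of
`s, t` is the central node `d`, and commutation `st = ts` otherwise. -/
def Rels : Set (FreeGroup Gen) :=
  { r | ∃ s t : Gen, s ≠ t ∧
      (((s = d ∨ t = d) ∧
          r = FreeGroup.of s * FreeGroup.of t * FreeGroup.of s *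
              (FreeGroup.of t * FreeGroup.of s * FreeGroup.of t)⁻¹) ∨
        ((s ≠ d ∧ t ≠ d) ∧
          r = FreeGroup.of s * FreeGroup.of t * (FreeGroup.of s)⁻¹ * (FreeGroup.of t)⁻¹)) }

/-- The Artin group of type `D₄`. -/
abbrev Artin : Type := PresentedGroup Rels

/-- The generators, as elements of the Artin group. -/
def gen (s : Gen) : Artin := PresentedGroup.of s

/-- The standard parabolic subgroup `A_ŝ` generated by the three generators other than `s`. -/
def Ahat (s : Gen) : Subgroup Artin :=
  Subgroup.closure { x | ∃ t : Gen, t ≠ s ∧ x = gen t }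

/-- `X` is a left coset of the subgroup `H`. -/
def IsCosetOf (X : Set Artin) (H : Subgroup Artin) : Prop :=
  ∃ g : Artin, X = g • (H : Set Artin)

/-- A type I 6-cycle: `x 0, x 2, x 4` are pairwise distinct left cosets of `A_â`,
`x 1, x 3, x 5` are pairwise distinct left cosets of `A_ĉ`, and consecutive cosets
(indices mod 6) have nonempty intersection. -/
def TypeI (x : Fin 6 → Set Artin) : Prop :=
  IsCosetOf (x 0) (Ahat a) ∧ IsCosetOf (x 2) (Ahat a) ∧ IsCosetOf (x 4) (Ahat a) ∧
  IsCosetOf (x 1) (Ahat c) ∧ IsCosetOf (x 3) (Ahat c) ∧ IsCosetOf (x 5) (Ahat c) ∧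
  x 0 ≠ x 2 ∧ x 0 ≠ x 4 ∧ x 2 ≠ x 4 ∧
  x 1 ≠ x 3 ∧ x 1 ≠ x 5 ∧ x 3 ≠ x 5 ∧
  ∀ i : Fin 6, (x i ∩ x (i + 1)).Nonempty

/-- Property `(*)` for a 6-cycle: there is a left coset of `A_â` or of `A_b̂` meeting each of
`x 1`, `x 3`, `x 5`. -/
def Star (x : Fin 6 → Set Artin) : Prop :=
  ∃ z : Set Artin, (IsCosetOf z (Ahat a) ∨ IsCosetOf z (Ahat b)) ∧
    (z ∩ x 1).Nonempty ∧ (z ∩ x 3).Nonempty ∧ (z ∩ x 5).Nonempty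

end D4Artin

namespace D4Artin

open Gen

section Presentation

variable {G : Type*} [Group G]

/-- A homomorphism out of the `D₄` Artin group, given by the images of the generators. -/
def Artin.lift (f : Gen → G)
    (had : f a * f d * f a = f d * f a * f d) (hbd : f b * f d * f b = f d * f b * f d)
    (hcd : f c * f d * f c = f d * f c * f d) (hab : f a * f b = f b * f a)
    (hac : f a * f c = f c * f a) (hbc : f b * f c = f c * f b) : Artin →* G :=
  PresentedGroup.toGroup (rels := Rels) (f := f) <| by
    rintro r ⟨s, t, hst, ⟨h, rfl⟩ | ⟨h, rfl⟩⟩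
    · rw [map_mul, map_inv, mul_inv_eq_one]
      cases s <;> cases t <;> simp_all
    · simp only [map_mul, map_inv, FreeGroup.lift_apply_of]
      rw [mul_inv_eq_one, mul_inv_eq_iff_eq_mul]
      cases s <;> cases t <;> simp_all

@[simp]
theorem Artin.lift_gen (f : Gen → G) (had hbd hcd hab hac hbc) (s : Gen) :
    Artin.lift f had hbd hcd hab hac hbc (gen s) = f s :=
  PresentedGroup.toGroup.of _

theorem Artin.hom_ext {f g : Artin →* G} (h : ∀ s, f (gen s) = g (gen s)) : f = g :=
  PresentedGroup.ext h

theorem Artin.braid {s : Gen} (hs : s ≠ d) :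
    gen s * gen d * gen s = gen d * gen s * gen d := by
  rw [← mul_inv_eq_one]
  exact PresentedGroup.one_of_mem ⟨s, d, hs, Or.inl ⟨Or.inr rfl, rfl⟩⟩

theorem Artin.comm {s t : Gen} (hs : s ≠ d) (ht : t ≠ d) : gen s * gen t = gen t * gen s := by
  rcases eq_or_ne s t with rfl | hst
  · rfl
  rw [← mul_inv_eq_iff_eq_mul, ← mul_inv_eq_one]
  exact PresentedGroup.one_of_mem ⟨s, t, hst, Or.inr ⟨⟨hs, ht⟩, rfl⟩⟩

theorem Artin.induction {p : Artin → Prop} (gen : ∀ s, p (gen s)) (one : p 1)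
    (mul : ∀ g h, p g → p h → p (g * h)) (inv : ∀ g, p g → p g⁻¹) (g : Artin) : p g := by
  have hg : g ∈ Subgroup.closure (Set.range (PresentedGroup.of (rels := Rels))) := by
    simp [PresentedGroup.closure_range_of]
  refine Subgroup.closure_induction (p := fun x _ => p x) ?_ one
    (fun x y _ _ => mul x y) (fun x _ => inv x) hg
  rintro _ ⟨s, rfl⟩
  exact gen s

theorem gen_mem_Ahat {s t : Gen} (h : t ≠ s) : gen t ∈ Ahat s :=
  Subgroup.subset_closure ⟨t, h, rfl⟩

theorem Ahat.induction {s : Gen} {p : ∀ g : Artin, g ∈ Ahat s → Prop}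
    (hgen : ∀ t (ht : t ≠ s), p (gen t) (gen_mem_Ahat ht)) (one : p 1 (one_mem _))
    (mul : ∀ g h hg hh, p g hg → p h hh → p (g * h) (mul_mem hg hh))
    (inv : ∀ g hg, p g hg → p g⁻¹ (inv_mem hg)) {g : Artin} (hg : g ∈ Ahat s) : p g hg := by
  refine Subgroup.closure_induction ?_ one mul inv hg
  rintro _ ⟨t, ht, rfl⟩
  exact hgen t ht

end Presentation

/-- The universal Coxeter group of rank four. -/
def W : Type := PresentedGroup (Set.range fun i : Fin 4 => FreeGroup.of i * FreeGroup.of i)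

namespace W

instance : Group W :=
  inferInstanceAs
    (Group (PresentedGroup (Set.range fun i : Fin 4 => FreeGroup.of i * FreeGroup.of i)))

variable {G : Type*} [Group G]

/-- The generating involutions of `W`. -/
def r (i : Fin 4) : W := PresentedGroup.of i

@[simp]
theorem r_mul_self (i : Fin 4) : r i * r i = 1 :=
  PresentedGroup.one_of_mem (rels := Set.range fun i : Fin 4 => FreeGroup.of i * FreeGroup.of i)
    ⟨i, rfl⟩

@[simp]
theorem r_mul_cancel_left (i : Fin 4) (w : W) : r i * (r i * w) = w := by
  rw [← mul_assoc, r_mul_self, one_mul]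

@[simp]
theorem r_inv (i : Fin 4) : (r i)⁻¹ = r i :=
  inv_eq_of_mul_eq_one_right (r_mul_self i)

/-- A homomorphism out of `W`, given by the images of the generating involutions. -/
def lift (f : Fin 4 → G) (hf : ∀ i, f i * f i = 1) : W →* G :=
  PresentedGroup.toGroup
    (rels := Set.range fun i : Fin 4 => FreeGroup.of i * FreeGroup.of i) (f := f) <| by
    rintro _ ⟨i, rfl⟩
    simp [hf]

@[simp]
theorem lift_r (f : Fin 4 → G) (hf) (i : Fin 4) : lift f hf (r i) = f i :=
  PresentedGroup.toGroup.of _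

theorem hom_ext {f g : W →* G} (h : ∀ i, f (r i) = g (r i)) : f = g :=
  PresentedGroup.ext h

theorem closure_range_r : Subgroup.closure (Set.range r) = ⊤ :=
  PresentedGroup.closure_range_of _

theorem induction_right {p : W → Prop} (one : p 1) (mul : ∀ w i, p w → p (w * r i)) (w : W) :
    p w := by
  have hw : w ∈ Subgroup.closure (Set.range r) := by simp [closure_range_r]
  refine Subgroup.closure_induction_right (p := fun x _ => p x) one ?_ ?_ hw
  · rintro x _ _ ⟨i, rfl⟩ h
    exact mul x i h
  · rintro x _ _ ⟨i, rfl⟩ h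
    rw [r_inv]
    exact mul x i h

/-- The underlying endomorphism of the Hurwitz move `hurwitz i`. -/
def hurwitzHom (i : Fin 3) : W →* W :=
  lift (fun k => if k = i.castSucc then r i.castSucc * r i.succ * r i.castSucc
    else if k = i.succ then r i.castSucc else r k) <| by
    intro k
    split_ifs <;> simp [mul_assoc]

/-- The underlying endomorphism of the inverse of the Hurwitz move `hurwitz i`. -/
def hurwitzInvHom (i : Fin 3) : W →* W :=
  lift (fun k => if k = i.castSucc then r i.succ
    else if k = i.succ then r i.succ * r i.castSucc * r i.succ else r k) <| by
    intro k
    split_ifs <;> simp [mul_assoc]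

/-- The Hurwitz move at the positions `i`, `i + 1`, as an automorphism of `W`. -/
def hurwitz (i : Fin 3) : MulAut W :=
  MonoidHom.toMulEquiv (hurwitzHom i) (hurwitzInvHom i)
    (hom_ext fun k => by
      fin_cases i <;> fin_cases k <;> simp [hurwitzHom, hurwitzInvHom, mul_assoc])
    (hom_ext fun k => by
      fin_cases i <;> fin_cases k <;> simp [hurwitzHom, hurwitzInvHom, mul_assoc])

theorem hurwitz_r (i : Fin 3) (k : Fin 4) :
    hurwitz i (r k) = if k = i.castSucc then r i.castSucc * r i.succ * r i.castSucc
      else if k = i.succ then r i.castSucc else r k :=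
  by
  change hurwitzHom i (r k) = _
  rw [hurwitzHom, lift_r]

theorem aut_ext {f g : MulAut W} (h : ∀ i, f (r i) = g (r i)) : f = g :=
  MulEquiv.toMonoidHom_injective (hom_ext h)

theorem hurwitz_braid₀₁ : hurwitz 0 * hurwitz 1 * hurwitz 0 = hurwitz 1 * hurwitz 0 * hurwitz 1 :=
  aut_ext fun k => by fin_cases k <;> simp [hurwitz_r, mul_assoc]

theorem hurwitz_braid₁₂ : hurwitz 2 * hurwitz 1 * hurwitz 2 = hurwitz 1 * hurwitz 2 * hurwitz 1 :=
  aut_ext fun k => by fin_cases k <;> simp [hurwitz_r, mul_assoc]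

theorem hurwitz_comm₀₂ : hurwitz 0 * hurwitz 2 = hurwitz 2 * hurwitz 0 :=
  aut_ext fun k => by fin_cases k <;> simp [hurwitz_r, mul_assoc]

/-- The parity of the length of an element of `W`. -/
def sign : W →* ℤˣ :=
  lift (fun _ => -1) (by simp)

@[simp]
theorem sign_r (i : Fin 4) : sign (r i) = -1 :=
  lift_r _ _ _

/-- The retraction of `W` killing the last generator. -/
def ρ : W →* W :=
  lift ![r 0, r 1, r 2, 1] (by simp [Fin.forall_fin_succ])

@[simp] theorem ρ_r₀ : ρ (r 0) = r 0 := lift_r _ _ _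
@[simp] theorem ρ_r₁ : ρ (r 1) = r 1 := lift_r _ _ _
@[simp] theorem ρ_r₂ : ρ (r 2) = r 2 := lift_r _ _ _
@[simp] theorem ρ_r₃ : ρ (r 3) = 1 := lift_r _ _ _

theorem ρ_ρ (w : W) : ρ (ρ w) = ρ w :=
  DFunLike.congr_fun (f := ρ.comp ρ) (g := ρ)
    (hom_ext fun k => by fin_cases k <;> simp) w

end W

/-- The affine Hurwitz representation of the `D₄` Artin group on `W`. -/
def affineRep : Artin →* W ⋊[MonoidHom.id (MulAut W)] MulAut W :=
  Artin.lift
    (fun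
      | a => ⟨1, W.hurwitz 0⟩
      | b => ⟨1, W.hurwitz 2⟩
      | c => ⟨W.r 1 * W.r 0, W.hurwitz 0⟩
      | d => ⟨1, W.hurwitz 1⟩)
    (by ext1 <;> simp [W.hurwitz_braid₀₁])
    (by ext1 <;> simp [W.hurwitz_braid₁₂])
    (by
      ext1
      · simp [W.hurwitz_r, mul_assoc]
      · simpa using W.hurwitz_braid₀₁)
    (by ext1 <;> simp [W.hurwitz_comm₀₂])
    (by ext1 <;> simp [W.hurwitz_r, mul_assoc])
    (by ext1 <;> simp [W.hurwitz_comm₀₂, W.hurwitz_r, mul_assoc])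

/-- The linear part of `affineRep`. -/
def lin : Artin →* MulAut W := SemidirectProduct.rightHom.comp affineRep

@[simp] theorem lin_gen_a : lin (gen a) = W.hurwitz 0 := by simp [lin, affineRep]
@[simp] theorem lin_gen_b : lin (gen b) = W.hurwitz 2 := by simp [lin, affineRep]
@[simp] theorem lin_gen_c : lin (gen c) = W.hurwitz 0 := by simp [lin, affineRep]
@[simp] theorem lin_gen_d : lin (gen d) = W.hurwitz 1 := by simp [lin, affineRep]

instance : MulAction Artin W where
  smul g w := (affineRep g).left * lin g w
  one_smul w := by
    change (affineRep 1).left * lin 1 w = w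
    simp
  mul_smul g h w := by
    change (affineRep (g * h)).left * lin (g * h) w =
      (affineRep g).left * lin g ((affineRep h).left * lin h w)
    simp only [map_mul, SemidirectProduct.mul_left, MulAut.mul_apply, MonoidHom.id_apply,
      mul_assoc]
    rfl

theorem smul_def (g : Artin) (w : W) : g • w = (affineRep g).left * lin g w := rfl

theorem smul_eq (g : Artin) (w : W) : g • w = g • (1 : W) * lin g w := by
  simp [smul_def]

theorem inv_smul_mul_smul (g : Artin) (v w : W) : (g • v)⁻¹ * g • w = lin g (v⁻¹ * w) := by
  simp [smul_def, mul_assoc]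

theorem gen_a_smul (w : W) : gen a • w = W.hurwitz 0 w := by
  rw [smul_def, lin_gen_a]
  simp [affineRep]

theorem gen_b_smul (w : W) : gen b • w = W.hurwitz 2 w := by
  rw [smul_def, lin_gen_b]
  simp [affineRep]

theorem gen_c_smul (w : W) : gen c • w = W.r 1 * W.r 0 * W.hurwitz 0 w := by
  rw [smul_def, lin_gen_c]
  simp [affineRep]

theorem gen_d_smul (w : W) : gen d • w = W.hurwitz 1 w := by
  rw [smul_def, lin_gen_d]
  simp [affineRep]

theorem smul_one_of_mem {g : Artin} (hg : g ∈ Ahat c) : g • (1 : W) = 1 := by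
  induction hg using Ahat.induction with
  | hgen t ht => cases t <;> simp_all [gen_a_smul, gen_b_smul, gen_d_smul]
  | one => simp
  | mul g h _ _ hg hh => rw [mul_smul, hh, hg]
  | inv g _ hg => rw [inv_smul_eq_iff, hg]

theorem smul_r_of_mem {g : Artin} (hg : g ∈ Ahat a) : g • W.r 0 = W.r 0 := by
  induction hg using Ahat.induction with
  | hgen t ht =>
    cases t <;> simp_all [gen_c_smul, gen_b_smul, gen_d_smul, W.hurwitz_r, mul_assoc]
  | one => simp
  | mul g h _ _ hg hh => rw [mul_smul, hh, hg]
  | inv g _ hg => rw [inv_smul_eq_iff, hg]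

theorem ρ_smul {g : Artin} (hg : g ∈ Ahat b) (w : W) : W.ρ (g • w) = g • W.ρ w := by
  have h₀ (w : W) : W.ρ (W.hurwitz 0 w) = W.hurwitz 0 (W.ρ w) :=
    DFunLike.congr_fun (f := W.ρ.comp (W.hurwitz 0).toMonoidHom)
      (g := (W.hurwitz 0).toMonoidHom.comp W.ρ)
      (W.hom_ext fun k => by fin_cases k <;> simp [W.hurwitz_r]) w
  have h₁ (w : W) : W.ρ (W.hurwitz 1 w) = W.hurwitz 1 (W.ρ w) :=
    DFunLike.congr_fun (f := W.ρ.comp (W.hurwitz 1).toMonoidHom)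
      (g := (W.hurwitz 1).toMonoidHom.comp W.ρ)
      (W.hom_ext fun k => by fin_cases k <;> simp [W.hurwitz_r]) w
  induction hg using Ahat.induction generalizing w with
  | hgen t ht => cases t <;> simp_all [gen_a_smul, gen_c_smul, gen_d_smul]
  | one => simp
  | mul g h _ _ hg hh => rw [mul_smul, hg, hh, mul_smul]
  | inv g _ hg => rw [eq_inv_smul_iff, ← hg, smul_inv_smul]

/-- The symmetry of the `D₄` Artin group exchanging `a` and `c`, as an endomorphism. -/
def swapHom : Artin →* Artin :=
  Artin.lift
    (fun
      | a => gen c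
      | b => gen b
      | c => gen a
      | d => gen d)
    (Artin.braid (by simp)) (Artin.braid (by simp)) (Artin.braid (by simp))
    (Artin.comm (by simp) (by simp)) (Artin.comm (by simp) (by simp))
    (Artin.comm (by simp) (by simp))

/-- The symmetry of the `D₄` Artin group exchanging `a` and `c`. -/
def swap : MulAut Artin :=
  MonoidHom.toMulEquiv swapHom swapHom
    (Artin.hom_ext fun s => by cases s <;> simp [swapHom])
    (Artin.hom_ext fun s => by cases s <;> simp [swapHom])

theorem swap_apply (g : Artin) : swap g = swapHom g := rfl

theorem swap_mul_swap : swap * swap = 1 :=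
  mul_eq_one_iff_eq_inv.mpr rfl

/-- The endomorphism of the `D₄` Artin group sending `c` to `a` and fixing `a`, `b`, `d`. -/
def fold : Artin →* Artin :=
  Artin.lift
    (fun
      | a => gen a
      | b => gen b
      | c => gen a
      | d => gen d)
    (Artin.braid (by simp)) (Artin.braid (by simp)) (Artin.braid (by simp))
    (Artin.comm (by simp) (by simp)) rfl
    (Artin.comm (by simp) (by simp))

theorem fold_mem (g : Artin) : fold g ∈ Ahat c := by
  induction g using Artin.induction with
  | gen s => cases s <;> simp [fold, gen_mem_Ahat]
  | one => simp [one_mem]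
  | mul g h hg hh => simpa using mul_mem hg hh
  | inv g hg => simpa using inv_mem hg

theorem lin_fold (g : Artin) : lin (fold g) = lin g :=
  DFunLike.congr_fun (f := lin.comp fold) (g := lin)
    (Artin.hom_ext fun s => by cases s <;> simp [fold]) g

theorem fold_smul (g : Artin) (w : W) : fold g • w = lin g w := by
  rw [smul_eq, smul_one_of_mem (fold_mem g), lin_fold, one_mul]

theorem swap_mem {g : Artin} (hg : g ∈ Ahat c) : swap g ∈ Ahat a := by
  induction hg using Ahat.induction with
  | hgen t ht => cases t <;> simp_all [swap_apply, swapHom, gen_mem_Ahat]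
  | one => simp [one_mem]
  | mul g h _ _ hg hh => simpa using mul_mem hg hh
  | inv g _ hg => simpa using inv_mem hg

section Conjugation

variable {G : Type*} [Group G]

theorem mul_conj_mul_of_commute {s x : G} (hs : s * s = 1) (h : Commute (s * x * s) x) :
    s * (x⁻¹ * s * x) * s = x * s * x⁻¹ := by
  have hs' : s⁻¹ = s := inv_eq_of_mul_eq_one_right hs
  have h' : s * x⁻¹ * s * x = x * (s * x⁻¹ * s) := by
    simpa [hs', mul_assoc] using h.inv_left.eq
  calc s * (x⁻¹ * s * x) * s = s * x⁻¹ * s * x * s := by group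
    _ = x * s * x⁻¹ * (s * s) := by rw [h']; group
    _ = x * s * x⁻¹ := by rw [hs, mul_one]

theorem conj_eq_of_braid {x y : G} (h : x * y * x = y * x * y) :
    (x * y)⁻¹ * y * (x * y) = x := by
  rw [mul_assoc, ← mul_assoc y, ← h]
  group

theorem commute_inv_conj {x y : G} (g : G) (h : Commute x y) :
    Commute (g⁻¹ * x * g) (g⁻¹ * y * g) := by
  simpa using (Commute.conj_iff g⁻¹).2 h

/-- Commutation of a generator with the conjugate of a commuting element along a braid. -/
theorem commute_conj_conj {x y z : G} (h : x * y * x = y * x * y) (hz : Commute y z) :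
    Commute x (y⁻¹ * (x⁻¹ * z * x) * y) := by
  have := commute_inv_conj (x * y) hz
  rw [conj_eq_of_braid h] at this
  convert this using 1
  group

/-- If `s` is an involution commuting with `y`, and `x, y` satisfy the braid relation, then
commutation of `s x s` and `x` propagates to the conjugate of `s` by `x`. -/
theorem commute_mul_conj {s x y : G} (h : x * y * x = y * x * y) (hy : Commute y s)
    (hx : Commute (s * x * s) x) :
    Commute (x⁻¹ * s * x * y * (x⁻¹ * s * x)) y := by
  have hyx : x * y * x⁻¹ = y⁻¹ * x * y := by
    rw [mul_inv_eq_iff_eq_mul, mul_assoc, mul_assoc, eq_inv_mul_iff_mul_eq, ← mul_assoc, ← h]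
    group
  have h₁ := commute_inv_conj (y * x) hx
  have e₁ : (y * x)⁻¹ * (s * x * s) * (y * x) = x⁻¹ * s * x * y * (x⁻¹ * s * x) := by
    calc (y * x)⁻¹ * (s * x * s) * (y * x) = x⁻¹ * (y⁻¹ * s) * x * (s * y) * x := by group
      _ = x⁻¹ * s * (y⁻¹ * x * y) * s * x := by
        rw [← hy.eq, (hy.inv_left).eq]; group
      _ = _ := by rw [← hyx]; group
  have e₂ : (y * x)⁻¹ * x * (y * x) = y := conj_eq_of_braid h.symm
  rwa [e₁, e₂] at h₁

end Conjugation

section Stabilizers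

open SemidirectProduct

/-- The involution exchanging `a` and `c`, in the extension of the `D₄` Artin group by its
automorphisms. -/
def swapElt : Artin ⋊[MonoidHom.id (MulAut Artin)] MulAut Artin := inr swap

theorem swapElt_mul_self : swapElt * swapElt = 1 := by
  rw [swapElt, ← map_mul, swap_mul_swap, map_one]

theorem swapElt_mul_inl (g : Artin) : swapElt * inl g = inl (swap g) * swapElt := by
  rw [← mul_inv_eq_iff_eq_mul]
  exact (inl_aut (φ := MonoidHom.id (MulAut Artin)) swap g).symm

/-- The homomorphism from `W` to the extended Artin group along which translations act. -/
def embed : W →* Artin ⋊[MonoidHom.id (MulAut Artin)] MulAut Artin :=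
  W.lift
    ![swapElt,
      inl (gen a)⁻¹ * swapElt * inl (gen a),
      inl (gen d)⁻¹ * inl (gen a)⁻¹ * swapElt * inl (gen a) * inl (gen d),
      inl (gen b)⁻¹ * inl (gen d)⁻¹ * inl (gen a)⁻¹ * swapElt * inl (gen a) * inl (gen d) *
        inl (gen b)]
    (by
      have h (x) : swapElt * (swapElt * x) = x := by
        rw [← mul_assoc, swapElt_mul_self, one_mul]
      simp [Fin.forall_fin_succ, mul_assoc, h, swapElt_mul_self])

theorem embed_r₀ : embed (W.r 0) = swapElt := W.lift_r _ _ _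

theorem embed_r₁ : embed (W.r 1) = (inl (gen a))⁻¹ * embed (W.r 0) * inl (gen a) := by
  simp [embed]

theorem embed_r₂ : embed (W.r 2) = (inl (gen d))⁻¹ * embed (W.r 1) * inl (gen d) := by
  simp [embed, mul_assoc]

theorem embed_r₃ : embed (W.r 3) = (inl (gen b))⁻¹ * embed (W.r 2) * inl (gen b) := by
  simp [embed, mul_assoc]

theorem embed_r_mul_self (i : Fin 4) : embed (W.r i) * embed (W.r i) = 1 := by
  rw [← map_mul, W.r_mul_self, map_one]

theorem inl_braid {s : Gen} (hs : s ≠ d) :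
    (inl (gen s) : Artin ⋊[MonoidHom.id (MulAut Artin)] MulAut Artin) * inl (gen d) *
      inl (gen s) = inl (gen d) * inl (gen s) * inl (gen d) := by
  simp only [← map_mul, Artin.braid hs]

theorem commute_inl_embed_r₀ {s : Gen} (ha : s ≠ a) (hc : s ≠ c) :
    Commute (inl (gen s)) (embed (W.r 0)) := by
  rw [embed_r₀, Commute, SemiconjBy, swapElt_mul_inl]
  cases s <;> simp_all [swap_apply, swapHom]

theorem commute_embed_r₀ :
    Commute (embed (W.r 0) * inl (gen a) * embed (W.r 0)) (inl (gen a)) := by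
  rw [embed_r₀, swapElt_mul_inl, mul_assoc, swapElt_mul_self, mul_one]
  have : Commute (gen c) (gen a) := Artin.comm (by simp) (by simp)
  simpa [swap_apply, swapHom] using
    this.map (inl : Artin →* Artin ⋊[MonoidHom.id (MulAut Artin)] MulAut Artin)

theorem commute_embed_r₁ :
    Commute (embed (W.r 1) * inl (gen d) * embed (W.r 1)) (inl (gen d)) := by
  rw [embed_r₁]
  exact commute_mul_conj (inl_braid (by simp))
    (commute_inl_embed_r₀ (by simp) (by simp)) commute_embed_r₀

theorem commute_inl_b_embed_r₁ : Commute (inl (gen b)) (embed (W.r 1)) := by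
  have : Commute (gen b) (gen a) := Artin.comm (by simp) (by simp)
  have h := this.map (inl : Artin →* Artin ⋊[MonoidHom.id (MulAut Artin)] MulAut Artin)
  rw [embed_r₁]
  exact (h.inv_right.mul_right (commute_inl_embed_r₀ (by simp) (by simp))).mul_right h

theorem commute_embed_r₂ :
    Commute (embed (W.r 2) * inl (gen b) * embed (W.r 2)) (inl (gen b)) := by
  rw [embed_r₂]
  exact commute_mul_conj (inl_braid (by simp)).symm commute_inl_b_embed_r₁ commute_embed_r₁

theorem commute_inl_a_embed_r₂ : Commute (inl (gen a)) (embed (W.r 2)) := by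
  rw [embed_r₂, embed_r₁]
  exact commute_conj_conj (inl_braid (by simp)) (commute_inl_embed_r₀ (by simp) (by simp))

theorem embed_hurwitz₀ (w : W) :
    embed (W.hurwitz 0 w) = inl (gen a) * embed w * (inl (gen a))⁻¹ := by
  refine DFunLike.congr_fun (f := embed.comp (W.hurwitz 0).toMonoidHom)
    (g := (MulAut.conj (inl (gen a))).toMonoidHom.comp embed) (W.hom_ext fun k => ?_) w
  have hab : Commute (gen a) (gen b) := Artin.comm (by simp) (by simp)
  have h := hab.map (inl : Artin →* Artin ⋊[MonoidHom.id (MulAut Artin)] MulAut Artin)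
  fin_cases k
  · simpa [W.hurwitz_r, embed_r₁] using
      mul_conj_mul_of_commute (embed_r_mul_self 0) commute_embed_r₀
  · simp [W.hurwitz_r, embed_r₁, mul_assoc]
  · simpa [W.hurwitz_r, eq_mul_inv_iff_mul_eq] using commute_inl_a_embed_r₂.symm.eq
  · have : Commute (inl (gen a)) (embed (W.r 3)) := by
      rw [embed_r₃]
      exact (h.inv_right.mul_right commute_inl_a_embed_r₂).mul_right h
    simpa [W.hurwitz_r, eq_mul_inv_iff_mul_eq] using this.symm.eq

theorem embed_hurwitz₁ (w : W) :
    embed (W.hurwitz 1 w) = inl (gen d) * embed w * (inl (gen d))⁻¹ := by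
  refine DFunLike.congr_fun (f := embed.comp (W.hurwitz 1).toMonoidHom)
    (g := (MulAut.conj (inl (gen d))).toMonoidHom.comp embed) (W.hom_ext fun k => ?_) w
  fin_cases k
  · have := commute_inl_embed_r₀ (s := d) (by simp) (by simp)
    simpa [W.hurwitz_r, eq_mul_inv_iff_mul_eq] using this.symm.eq
  · simpa [W.hurwitz_r, embed_r₂] using
      mul_conj_mul_of_commute (embed_r_mul_self 1) commute_embed_r₁
  · simp [W.hurwitz_r, embed_r₂, mul_assoc]
  · have : Commute (inl (gen d)) (embed (W.r 3)) := by
      rw [embed_r₃, embed_r₂]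
      exact commute_conj_conj (inl_braid (by simp)).symm commute_inl_b_embed_r₁
    simpa [W.hurwitz_r, eq_mul_inv_iff_mul_eq] using this.symm.eq

theorem embed_hurwitz₂ (w : W) :
    embed (W.hurwitz 2 w) = inl (gen b) * embed w * (inl (gen b))⁻¹ := by
  refine DFunLike.congr_fun (f := embed.comp (W.hurwitz 2).toMonoidHom)
    (g := (MulAut.conj (inl (gen b))).toMonoidHom.comp embed) (W.hom_ext fun k => ?_) w
  fin_cases k
  · have := commute_inl_embed_r₀ (s := b) (by simp) (by simp)
    simpa [W.hurwitz_r, eq_mul_inv_iff_mul_eq] using this.symm.eq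
  · simpa [W.hurwitz_r, eq_mul_inv_iff_mul_eq] using commute_inl_b_embed_r₁.symm.eq
  · simpa [W.hurwitz_r, embed_r₃] using
      mul_conj_mul_of_commute (embed_r_mul_self 2) commute_embed_r₂
  · simp [W.hurwitz_r, embed_r₃, mul_assoc]

theorem inl_mul_embed (g : Artin) (w : W) :
    inl g * embed w = embed (g • w) * inl (fold g) := by
  induction g using Artin.induction generalizing w with
  | gen s =>
    cases s
    · simp [gen_a_smul, embed_hurwitz₀, fold]
    · simp [gen_b_smul, embed_hurwitz₂, fold]
    · have hac : Commute (gen c) (gen a) := Artin.comm (by simp) (by simp)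
      have h : embed (W.r 1) * embed (W.r 0) = inl (gen c) * (inl (gen a))⁻¹ := by
        rw [embed_r₁, mul_assoc, mul_assoc, ← mul_assoc (embed (W.r 0)), embed_r₀,
          swapElt_mul_inl, mul_assoc, swapElt_mul_self, mul_one, ← map_inv, ← map_mul,
          ← map_mul]
        simpa [swap_apply, swapHom] using
          congrArg (inl : Artin →* Artin ⋊[MonoidHom.id (MulAut Artin)] MulAut Artin)
            hac.inv_right.symm.eq
      rw [gen_c_smul, map_mul, map_mul, h, embed_hurwitz₀]
      simp [fold, mul_assoc]
    · simp [gen_d_smul, embed_hurwitz₁, fold]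
  | one => simp
  | mul g h hg hh => rw [map_mul, mul_assoc, hh, ← mul_assoc, hg, mul_smul, map_mul, map_mul,
      mul_assoc]
  | inv g hg =>
    rw [map_inv, inv_mul_eq_iff_eq_mul, ← mul_assoc, hg, smul_inv_smul, map_inv, map_inv,
      mul_inv_cancel_right]

theorem smul_one_eq_iff {g : Artin} : g • (1 : W) = 1 ↔ g ∈ Ahat c := by
  refine ⟨fun h => ?_, smul_one_of_mem⟩
  have := inl_mul_embed g 1
  rw [h, map_one, one_mul, mul_one] at this
  rw [inl_injective this]
  exact fold_mem g

theorem smul_r_eq_iff {g : Artin} : g • W.r 0 = W.r 0 ↔ g ∈ Ahat a := by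
  refine ⟨fun h => ?_, smul_r_of_mem⟩
  have := inl_mul_embed g (W.r 0)
  rw [h, embed_r₀, swapElt_mul_inl, mul_left_inj] at this
  rw [inl_injective this]
  exact swap_mem (fold_mem g)

end Stabilizers

theorem of_mul_of_comm_iff {α : Type*} {x y : α} :
    FreeGroup.of x * FreeGroup.of y = FreeGroup.of y * FreeGroup.of x ↔ x = y := by
  classical
  refine ⟨fun h => ?_, fun h => by rw [h]⟩
  by_contra hxy
  have := congrArg (FreeGroup.lift fun z =>
    if z = x then Equiv.swap (0 : Fin 3) 1 else Equiv.swap 1 2) h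
  simp [Ne.symm hxy] at this
  exact absurd this (by decide)

theorem isCyclic_of_comm {G : Type*} [Group G] [IsFreeGroup G]
    (h : ∀ x y : G, x * y = y * x) : IsCyclic G := by
  have hs : Subsingleton (IsFreeGroup.Generators G) := ⟨fun x y => by
    rw [← of_mul_of_comm_iff]
    apply (IsFreeGroup.mulEquiv G).injective
    rw [map_mul, map_mul, h]⟩
  rw [← (IsFreeGroup.mulEquiv G).isCyclic]
  rcases isEmpty_or_nonempty (IsFreeGroup.Generators G) with he | ⟨⟨x⟩⟩
  · infer_instance
  · have := uniqueOfSubsingleton x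
    infer_instance

theorem exists_zpow_of_commute {α : Type*} {u v : FreeGroup α} (h : Commute u v) :
    ∃ (x : FreeGroup α) (m k : ℤ), u = x ^ m ∧ v = x ^ k := by
  let H := Subgroup.closure {u, v}
  have hH : IsMulCommutative H := Subgroup.isMulCommutative_closure fun x hx y hy => by
    rcases hx with rfl | rfl <;> rcases hy with rfl | rfl
    exacts [rfl, h.eq, h.eq.symm, rfl]
  have hc : IsCyclic H := isCyclic_of_comm fun x y => mul_comm' x y
  obtain ⟨x, hx⟩ := hc.exists_generator
  obtain ⟨m, hm⟩ := hx ⟨u, Subgroup.subset_closure (by simp)⟩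
  obtain ⟨k, hk⟩ := hx ⟨v, Subgroup.subset_closure (by simp)⟩
  exact ⟨x, m, k, by simpa using congrArg Subtype.val hm.symm,
    by simpa using congrArg Subtype.val hk.symm⟩

namespace W

/-- The automorphism of a free group inverting all the generators. -/
def invGens : MulAut (FreeGroup (Fin 4)) :=
  MonoidHom.toMulEquiv (FreeGroup.lift fun i => (FreeGroup.of i)⁻¹)
    (FreeGroup.lift fun i => (FreeGroup.of i)⁻¹) (by ext; simp) (by ext; simp)

theorem invGens_of (i : Fin 4) : invGens (FreeGroup.of i) = (FreeGroup.of i)⁻¹ := by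
  change FreeGroup.lift (fun i => (FreeGroup.of i)⁻¹) (FreeGroup.of i) = _
  rw [FreeGroup.lift_apply_of]

theorem invGens_mul_self : invGens * invGens = 1 :=
  mul_eq_one_iff_eq_inv.mpr rfl

/-- The embedding of `W` in an extension of a free group by the involution `invGens`. -/
def toFree : W →* FreeGroup (Fin 4) ⋊[MonoidHom.id _] MulAut (FreeGroup (Fin 4)) :=
  lift (fun i => ⟨FreeGroup.of i, invGens⟩) fun i => by
    ext1
    · simp [invGens_of]
    · simp [invGens_mul_self]

/-- The homomorphism to `W` inverting `toFree` on elements of even length. -/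
def ofFree : FreeGroup (Fin 4) →* W := FreeGroup.lift fun i => r i * r 0

theorem toFree_cases (w : W) :
    (sign w = 1 ∧ (toFree w).right = 1 ∧ ofFree (toFree w).left = w) ∨
      (sign w = -1 ∧ (toFree w).right = invGens ∧ ofFree (toFree w).left = w * r 0) := by
  induction w using induction_right with
  | one => simp
  | mul w i hw =>
    have hi : toFree (r i) = ⟨FreeGroup.of i, invGens⟩ := lift_r _ _ _
    rcases hw with ⟨h₁, h₂, h₃⟩ | ⟨h₁, h₂, h₃⟩
    · right
      simp only [map_mul, hi, SemidirectProduct.mul_left, SemidirectProduct.mul_right, h₁, h₂, h₃]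
      simp [ofFree, mul_assoc]
    · left
      simp only [map_mul, hi, SemidirectProduct.mul_left, SemidirectProduct.mul_right, h₁, h₂, h₃,
        MonoidHom.id_apply, invGens_of, map_inv, invGens_mul_self]
      simp [ofFree, mul_assoc]

theorem sign_eq_or (w : W) : sign w = 1 ∨ sign w = -1 := Int.units_eq_one_or _

theorem toFree_right {w : W} (hw : sign w = 1) : (toFree w).right = 1 := by
  rcases toFree_cases w with h | h
  · exact h.2.1
  · simp [hw] at h

theorem ofFree_toFree {w : W} (hw : sign w = 1) : ofFree (toFree w).left = w := by
  rcases toFree_cases w with h | h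
  · exact h.2.2
  · simp [hw] at h

/-- The isomorphism of the even subgroup with a subgroup of a free group. -/
def evenToFree : sign.ker →* FreeGroup (Fin 4) where
  toFun w := (toFree w).left
  map_one' := by simp
  map_mul' v w := by simp [toFree_right v.2]

theorem evenToFree_injective : Function.Injective evenToFree := fun v w h => by
  rw [Subtype.ext_iff, ← ofFree_toFree v.2, ← ofFree_toFree w.2]
  exact congrArg ofFree h

instance : IsMulTorsionFree sign.ker :=
  evenToFree_injective.isMulTorsionFree _

/-- Even elements fixed, respectively killed, by `ρ` do not commute unless one is trivial. -/
theorem eq_one_of_commute {g e : W} (hg : sign g = 1) (he : sign e = 1) (h : Commute g e)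
    (hρg : ρ g = 1) (hρe : ρ e = e) (hne : e ≠ 1) : g = 1 := by
  obtain ⟨x, m, k, hm, hk⟩ := exists_zpow_of_commute
    (u := evenToFree ⟨g, hg⟩) (v := evenToFree ⟨e, he⟩) <| by
      rw [Commute, SemiconjBy, ← map_mul, ← map_mul]
      exact congrArg _ (Subtype.ext h.eq)
  have hge : (⟨g, hg⟩ : sign.ker) ^ k = ⟨e, he⟩ ^ m := by
    apply evenToFree_injective
    rw [map_zpow, map_zpow, hm, hk, ← zpow_mul, ← zpow_mul, mul_comm]
  have hge' : g ^ k = e ^ m := congrArg Subtype.val hge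
  have hem : (⟨e, he⟩ : sign.ker) ^ m = 1 := Subtype.ext <| by
    have := congrArg ρ hge'
    rw [map_zpow, map_zpow, hρg, hρe, one_zpow] at this
    exact this.symm
  rcases IsMulTorsionFree.zpow_eq_one_iff.mp hem with h₁ | rfl
  · exact absurd (congrArg Subtype.val h₁) hne
  · rw [zpow_zero, ← map_one evenToFree] at hm
    exact congrArg Subtype.val (evenToFree_injective hm)

theorem eq_one_of_sq {w : W} (hw : sign w = 1) (h : w * w = 1) : w = 1 := by
  have : (⟨w, hw⟩ : sign.ker) ^ (2 : ℤ) = 1 := Subtype.ext (by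
    rw [zpow_two]
    exact h)
  rcases IsMulTorsionFree.zpow_eq_one_iff.mp this with h | h
  · exact congrArg Subtype.val h
  · simp at h

/-- If the product of two distinct odd involutions is fixed by `ρ`, then so are they. -/
theorem ρ_eq_of_ρ_mul_eq {s t : W} (hs : sign s = -1) (ht : sign t = -1) (hs₂ : s * s = 1)
    (ht₂ : t * t = 1) (hst : s ≠ t) (h : ρ (s * t) = s * t) : ρ s = s := by
  have he : sign (s * t) = 1 := by simp [hs, ht]
  have hne : s * t ≠ 1 := fun h1 => hst (by rw [mul_eq_one_iff_eq_inv.mp h1,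
    inv_eq_of_mul_eq_one_right ht₂])
  have hρs₂ : ρ s * ρ s = 1 := by rw [← map_mul, hs₂, map_one]
  have hs' : s⁻¹ = s := inv_eq_of_mul_eq_one_right hs₂
  have ht' : t⁻¹ = t := inv_eq_of_mul_eq_one_right ht₂
  have hρs' : (ρ s)⁻¹ = ρ s := inv_eq_of_mul_eq_one_right hρs₂
  have hconj : s * (s * t) * s = (s * t)⁻¹ := by
    rw [← mul_assoc, hs₂, one_mul, mul_inv_rev, hs', ht']
  have hρconj : ρ s * (s * t) * ρ s = (s * t)⁻¹ := by
    rw [← h, ← map_mul, ← map_mul, hconj, map_inv]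
  rcases sign_eq_or (ρ s) with h₁ | h₁
  · rw [eq_one_of_sq h₁ hρs₂, one_mul, mul_one] at hρconj
    exact absurd (eq_one_of_sq he (mul_eq_one_iff_eq_inv.mpr hρconj)) hne
  · have : ρ s * s = 1 := by
      refine eq_one_of_commute (by simp [h₁, hs]) he ?_ (by rw [map_mul, ρ_ρ, hρs₂]) h hne
      have h₂ : s * (s * t) = (s * t)⁻¹ * s := by rw [← hconj, mul_assoc, hs₂, mul_one]
      have h₃ : ρ s * (s * t)⁻¹ = s * t * ρ s := by
        rw [← hρconj, ← mul_assoc, ← mul_assoc, hρs₂, one_mul]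
      rw [Commute, SemiconjBy, mul_assoc, h₂, ← mul_assoc, h₃, mul_assoc]
    rw [mul_eq_one_iff_eq_inv.mp this, hs']

end W

theorem sign_hurwitz (i : Fin 3) (w : W) : W.sign (W.hurwitz i w) = W.sign w :=
  DFunLike.congr_fun (f := W.sign.comp (W.hurwitz i).toMonoidHom) (g := W.sign)
    (W.hom_ext fun k => by fin_cases i <;> fin_cases k <;> simp [W.hurwitz_r]) w

theorem sign_lin (g : Artin) (w : W) : W.sign (lin g w) = W.sign w := by
  induction g using Artin.induction generalizing w with
  | gen s => cases s <;> simp [sign_hurwitz]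
  | one => simp
  | mul g h hg hh => rw [map_mul, MulAut.mul_apply, hg, hh]
  | inv g hg => rw [← hg, map_inv, MulAut.apply_inv_self]

theorem sign_smul (g : Artin) (w : W) : W.sign (g • w) = W.sign w := by
  induction g using Artin.induction generalizing w with
  | gen s =>
    cases s <;> simp [gen_a_smul, gen_b_smul, gen_c_smul, gen_d_smul, sign_hurwitz]
  | one => simp
  | mul g h hg hh => rw [mul_smul, hg, hh]
  | inv g hg => rw [← hg, smul_inv_smul]

/-- The homomorphism sending the generators of `W` to the triple `r 0, r 1, r 2` with `1` inserted
at position `j`. -/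
def face (j : Fin 4) : W →* W :=
  W.lift
    (![![1, W.r 0, W.r 1, W.r 2], ![W.r 0, 1, W.r 1, W.r 2], ![W.r 0, W.r 1, 1, W.r 2],
      ![W.r 0, W.r 1, W.r 2, 1]] j)
    (by fin_cases j <;> simp [Fin.forall_fin_succ])

theorem face_three : face 3 = W.ρ := rfl

/-- The symmetric group quotient of the `D₄` Artin group through which it permutes the positions
of a quadruple. -/
def perm : Artin →* Equiv.Perm (Fin 4) :=
  Artin.lift
    (fun
      | a => Equiv.swap 0 1
      | b => Equiv.swap 2 3
      | c => Equiv.swap 0 1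
      | d => Equiv.swap 1 2)
    (by decide) (by decide) (by decide) (by decide) (by decide) (by decide)

theorem face_hurwitz (i : Fin 3) (j : Fin 4) :
    ∃ h, ∀ w, face j (W.hurwitz i w) = lin h (face (Equiv.swap i.castSucc i.succ j) w) := by
  let h : Artin := ![![1, 1, gen a, gen a], ![gen a, 1, 1, gen d], ![gen d, gen d, 1, 1]] i j
  refine ⟨h, DFunLike.congr_fun (f := (face j).comp (W.hurwitz i).toMonoidHom)
    (g := (lin h).toMonoidHom.comp (face (Equiv.swap i.castSucc i.succ j)))
    (W.hom_ext fun k => ?_)⟩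
  fin_cases i <;> fin_cases j <;> fin_cases k <;> simp [h, face, W.hurwitz_r, Equiv.swap_apply_def]

theorem face_lin (g : Artin) (j : Fin 4) :
    ∃ h, ∀ w, face j (lin g w) = lin h (face ((perm g)⁻¹ j) w) := by
  induction g using Artin.induction generalizing j with
  | gen s =>
    cases s
    · simpa [perm] using face_hurwitz 0 j
    · simpa [perm] using face_hurwitz 2 j
    · simpa [perm] using face_hurwitz 0 j
    · simpa [perm] using face_hurwitz 1 j
  | one => exact ⟨1, by simp⟩
  | mul g g' hg hg' =>
    obtain ⟨h, hh⟩ := hg j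
    obtain ⟨h', hh'⟩ := hg' ((perm g)⁻¹ j)
    exact ⟨h * h', fun w => by
      rw [map_mul, map_mul, map_mul, MulAut.mul_apply, MulAut.mul_apply, hh, hh', mul_inv_rev]
      rfl⟩
  | inv g hg =>
    obtain ⟨h, hh⟩ := hg (perm g j)
    refine ⟨h⁻¹, fun w => ?_⟩
    have hj : (perm g)⁻¹ (perm g j) = j := by simp
    have := hh (lin g⁻¹ w)
    rw [hj, map_inv, MulAut.apply_inv_self] at this
    rw [map_inv, map_inv, map_inv, inv_inv, this, MulAut.inv_apply_self]

/-- The reflections of `W`, that is the images of `r 0` under the linear Hurwitz action. -/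
def T : Set W := Set.range fun g => lin g (W.r 0)

theorem lin_mem_T {g : Artin} {w : W} : lin g w ∈ T ↔ w ∈ T := by
  constructor
  · rintro ⟨h, hh⟩
    exact ⟨g⁻¹ * h, by simpa using congrArg (lin g⁻¹) hh⟩
  · rintro ⟨h, rfl⟩
    exact ⟨g * h, by simp⟩

theorem sign_of_mem_T {t : W} (ht : t ∈ T) : W.sign t = -1 := by
  obtain ⟨g, rfl⟩ := ht
  rw [sign_lin, W.sign_r]

theorem mul_self_of_mem_T {t : W} (ht : t ∈ T) : t * t = 1 := by
  obtain ⟨g, rfl⟩ := ht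
  simp only [← map_mul, W.r_mul_self, map_one]

theorem r₀_mem_T : W.r 0 ∈ T := ⟨1, by simp⟩

theorem ρ_mem_T {t : W} (ht : t ∈ T) : W.ρ t = 1 ∨ W.ρ t ∈ T := by
  obtain ⟨g, rfl⟩ := ht
  obtain ⟨h, hh⟩ := face_lin g 3
  simp only [← face_three, hh, lin_mem_T]
  generalize (perm g)⁻¹ 3 = j
  fin_cases j
  · simp [face]
  all_goals
    right
    simpa [face] using r₀_mem_T

/-- The elements of `W` by which some element of `A_b̂` acts as a left translation. -/
def translations : Subgroup W where
  carrier := {w | ∃ g ∈ Ahat b, ∀ v, g • v = w * v}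
  one_mem' := ⟨1, one_mem _, by simp⟩
  mul_mem' := by
    rintro v w ⟨g, hg, hgv⟩ ⟨h, hh, hhw⟩
    exact ⟨g * h, mul_mem hg hh, fun u => by rw [mul_smul, hhw, hgv, mul_assoc]⟩
  inv_mem' := by
    rintro v ⟨g, hg, hgv⟩
    exact ⟨g⁻¹, inv_mem hg, fun u => by rw [inv_smul_eq_iff, hgv, mul_inv_cancel_left]⟩

theorem r_mul_r₀_mem (i : Fin 3) : W.r i.castSucc * W.r 0 ∈ translations := by
  have hc : gen c ∈ Ahat b := gen_mem_Ahat (by simp)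
  have ha : gen a ∈ Ahat b := gen_mem_Ahat (by simp)
  have hd : gen d ∈ Ahat b := gen_mem_Ahat (by simp)
  have h₁ (v : W) : (gen c * (gen a)⁻¹) • v = W.r 1 * W.r 0 * v := by
    rw [mul_smul, gen_c_smul, ← gen_a_smul, smul_inv_smul]
  fin_cases i
  · simp [one_mem]
  · exact ⟨_, mul_mem hc (inv_mem ha), h₁⟩
  · refine ⟨(gen d)⁻¹ * (gen c * (gen a)⁻¹) * gen d,
      mul_mem (mul_mem (inv_mem hd) (mul_mem hc (inv_mem ha))) hd, fun v => ?_⟩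
    rw [mul_smul, mul_smul, h₁, inv_smul_eq_iff, gen_d_smul, gen_d_smul, map_mul]
    simp [W.hurwitz_r]

theorem ρ_mem_translations (w : W) :
    (W.sign (W.ρ w) = 1 ∧ W.ρ w ∈ translations) ∨
      (W.sign (W.ρ w) = -1 ∧ W.ρ w * W.r 0 ∈ translations) := by
  have key (w : W) (j : Fin 3) (hw : (W.sign w = 1 ∧ w ∈ translations) ∨
      (W.sign w = -1 ∧ w * W.r 0 ∈ translations)) :
      (W.sign (w * W.r j.castSucc) = 1 ∧ w * W.r j.castSucc ∈ translations) ∨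
      (W.sign (w * W.r j.castSucc) = -1 ∧ w * W.r j.castSucc * W.r 0 ∈ translations) := by
    rcases hw with ⟨h₁, h₂⟩ | ⟨h₁, h₂⟩
    · exact Or.inr ⟨by simp [h₁], by rw [mul_assoc]; exact mul_mem h₂ (r_mul_r₀_mem j)⟩
    · refine Or.inl ⟨by simp [h₁], ?_⟩
      simpa [mul_assoc] using mul_mem h₂ (inv_mem (r_mul_r₀_mem j))
  induction w using W.induction_right with
  | one => simp [one_mem]
  | mul w i hw =>
    rw [map_mul]
    fin_cases i
    · simpa using key _ 0 hw
    · simpa using key _ 1 hw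
    · simpa using key _ 2 hw
    · simpa using hw

theorem exists_smul_one_eq {w : W} (hw : W.sign w = 1) (hρ : W.ρ w = w) :
    ∃ g ∈ Ahat b, g • (1 : W) = w := by
  have := ρ_mem_translations w
  simp only [hρ, hw] at this
  rcases this with ⟨-, g, hg, h⟩ | ⟨h, -⟩
  · exact ⟨g, hg, by rw [h, mul_one]⟩
  · simp at h

theorem exists_smul_r₀_eq {w : W} (hw : W.sign w = -1) (hρ : W.ρ w = w) :
    ∃ g ∈ Ahat b, g • W.r 0 = w := by
  have := ρ_mem_translations w
  simp only [hρ, hw] at this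
  rcases this with ⟨h, -⟩ | ⟨-, g, hg, h⟩
  · simp at h
  · exact ⟨g, hg, by simp [h, mul_assoc]⟩

theorem inv_mul_mem_T_comm {v w : W} : v⁻¹ * w ∈ T ↔ w⁻¹ * v ∈ T := by
  have key {v w : W} (h : v⁻¹ * w ∈ T) : w⁻¹ * v ∈ T := by
    rwa [← inv_eq_of_mul_eq_one_right (mul_self_of_mem_T h), mul_inv_rev, inv_inv] at h
  exact ⟨key, key⟩

theorem ρ_eq_of_inv_mul_mem_T {u v w : W} (hu : W.ρ u = u) (hv : W.ρ v = v) (huv : u ≠ v)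
    (huw : u⁻¹ * w ∈ T) (hvw : v⁻¹ * w ∈ T) : W.ρ w = w := by
  have hmul : u⁻¹ * w * (v⁻¹ * w) = u⁻¹ * v := by
    have hinv := inv_eq_of_mul_eq_one_right (mul_self_of_mem_T hvw)
    calc u⁻¹ * w * (v⁻¹ * w) = u⁻¹ * w * (v⁻¹ * w)⁻¹ := by rw [hinv]
      _ = u⁻¹ * v := by group
  have h := W.ρ_eq_of_ρ_mul_eq (sign_of_mem_T huw) (sign_of_mem_T hvw) (mul_self_of_mem_T huw)
    (mul_self_of_mem_T hvw) (fun h => huv (inv_injective (mul_right_cancel h)))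
    (by rw [hmul, map_mul, map_inv, hu, hv])
  rw [map_mul, map_inv, hu] at h
  exact mul_left_cancel h

theorem retract_path {w₁ w₂ w₃ w₄ : W} (h₁ : W.ρ w₁ = w₁) (h₄ : W.ρ w₄ = w₄)
    (h₁₂ : w₁⁻¹ * w₂ ∈ T) (h₂₃ : w₂⁻¹ * w₃ ∈ T) (h₃₄ : w₃⁻¹ * w₄ ∈ T) :
    w₁⁻¹ * w₄ ∈ T ∨
      (w₁⁻¹ * W.ρ w₂ ∈ T ∧ (W.ρ w₂)⁻¹ * W.ρ w₃ ∈ T ∧ (W.ρ w₃)⁻¹ * w₄ ∈ T) := by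
  have hs : W.sign (w₁⁻¹ * w₄) = -1 := by
    have : w₁⁻¹ * w₄ = w₁⁻¹ * w₂ * (w₂⁻¹ * w₃) * (w₃⁻¹ * w₄) := by group
    rw [this, map_mul, map_mul, sign_of_mem_T h₁₂, sign_of_mem_T h₂₃, sign_of_mem_T h₃₄]
    rfl
  have e₁ : W.ρ (w₁⁻¹ * w₂) = w₁⁻¹ * W.ρ w₂ := by rw [map_mul, map_inv, h₁]
  have e₂ : W.ρ (w₂⁻¹ * w₃) = (W.ρ w₂)⁻¹ * W.ρ w₃ := by rw [map_mul, map_inv]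
  have e₃ : W.ρ (w₃⁻¹ * w₄) = (W.ρ w₃)⁻¹ * w₄ := by rw [map_mul, map_inv, h₄]
  have hprod : w₁⁻¹ * w₄ = w₁⁻¹ * W.ρ w₂ * ((W.ρ w₂)⁻¹ * W.ρ w₃) * ((W.ρ w₃)⁻¹ * w₄) := by
    group
  have hne : (1 : ℤˣ) ≠ -1 := by decide
  have r₁ := ρ_mem_T h₁₂
  have r₂ := ρ_mem_T h₂₃
  have r₃ := ρ_mem_T h₃₄
  rw [e₁] at r₁
  rw [e₂] at r₂
  rw [e₃] at r₃
  rw [hprod] at hs ⊢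
  rcases r₁ with r₁ | r₁ <;> rcases r₂ with r₂ | r₂ <;> rcases r₃ with r₃ | r₃
  · simp [r₁, r₂, r₃, hne] at hs
  · exact Or.inl (by simpa [r₁, r₂] using r₃)
  · exact Or.inl (by simpa [r₁, r₃] using r₂)
  · rw [r₁, one_mul, map_mul, sign_of_mem_T r₂, sign_of_mem_T r₃] at hs
    exact absurd hs (by decide)
  · exact Or.inl (by simpa [r₂, r₃] using r₁)
  · rw [r₂, mul_one, map_mul, sign_of_mem_T r₁, sign_of_mem_T r₃] at hs
    exact absurd hs (by decide)
  · rw [r₃, mul_one, map_mul, sign_of_mem_T r₁, sign_of_mem_T r₂] at hs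
    exact absurd hs (by decide)
  · exact Or.inr ⟨r₁, r₂, r₃⟩

theorem meets_iff {G : Type*} [Group G] {H K : Subgroup G} {g h : G} :
    (g • (H : Set G) ∩ h • (K : Set G)).Nonempty ↔ ∃ f, g⁻¹ * f ∈ H ∧ h⁻¹ * f ∈ K := by
  simp only [Set.Nonempty, Set.mem_inter_iff, mem_leftCoset_iff, SetLike.mem_coe]

theorem inv_mul_mem_Ahat_c {g f : Artin} : g⁻¹ * f ∈ Ahat c ↔ f • (1 : W) = g • (1 : W) := by
  rw [← smul_one_eq_iff, mul_smul, inv_smul_eq_iff]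

theorem inv_mul_mem_Ahat_a {g f : Artin} : g⁻¹ * f ∈ Ahat a ↔ f • W.r 0 = g • W.r 0 := by
  rw [← smul_r_eq_iff, mul_smul, inv_smul_eq_iff]

theorem smul_Ahat_c_eq_iff {g h : Artin} (k : Artin) :
    g • (Ahat c : Set Artin) = h • (Ahat c : Set Artin) ↔
      (k⁻¹ * g) • (1 : W) = (k⁻¹ * h) • (1 : W) := by
  rw [leftCoset_eq_iff, inv_mul_mem_Ahat_c, mul_smul, mul_smul, smul_left_cancel_iff, eq_comm]

theorem smul_Ahat_a_eq_iff {g h : Artin} (k : Artin) :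
    g • (Ahat a : Set Artin) = h • (Ahat a : Set Artin) ↔
      (k⁻¹ * g) • W.r 0 = (k⁻¹ * h) • W.r 0 := by
  rw [leftCoset_eq_iff, inv_mul_mem_Ahat_a, mul_smul, mul_smul, smul_left_cancel_iff, eq_comm]

theorem meets_c_a_iff {g h : Artin} (k : Artin) :
    (g • (Ahat c : Set Artin) ∩ h • (Ahat a : Set Artin)).Nonempty ↔
      ((k⁻¹ * g) • (1 : W))⁻¹ * (k⁻¹ * h) • W.r 0 ∈ T := by
  rw [mul_smul, mul_smul, inv_smul_mul_smul, lin_mem_T, meets_iff]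
  simp only [inv_mul_mem_Ahat_c, inv_mul_mem_Ahat_a]
  constructor
  · rintro ⟨f, h₁, h₂⟩
    rw [← h₁, ← h₂, inv_smul_mul_smul, inv_one, one_mul]
    exact ⟨f, rfl⟩
  · rintro ⟨f, hf⟩
    refine ⟨g * fold (g⁻¹ * f), ?_, ?_⟩
    · rw [mul_smul, smul_one_of_mem (fold_mem _)]
    · dsimp only at hf
      rw [mul_smul, fold_smul, smul_eq g, ← MulAut.mul_apply, ← map_mul, mul_inv_cancel_left, hf,
        mul_inv_cancel_left]

theorem meets_c_b_iff {g k : Artin} :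
    (g • (Ahat c : Set Artin) ∩ k • (Ahat b : Set Artin)).Nonempty ↔
      W.ρ ((k⁻¹ * g) • (1 : W)) = (k⁻¹ * g) • (1 : W) := by
  rw [meets_iff]
  simp only [inv_mul_mem_Ahat_c]
  constructor
  · rintro ⟨f, h₁, h₂⟩
    rw [mul_smul, ← h₁, ← mul_smul, ρ_smul h₂, map_one]
  · intro h
    obtain ⟨f, hf, hfg⟩ := exists_smul_one_eq (by rw [sign_smul, map_one]) h
    exact ⟨k * f, by rw [mul_smul, hfg, ← mul_smul, mul_inv_cancel_left], by simpa using hf⟩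

theorem meets_a_b_iff {h k : Artin} :
    (h • (Ahat a : Set Artin) ∩ k • (Ahat b : Set Artin)).Nonempty ↔
      W.ρ ((k⁻¹ * h) • W.r 0) = (k⁻¹ * h) • W.r 0 := by
  rw [meets_iff]
  simp only [inv_mul_mem_Ahat_a]
  constructor
  · rintro ⟨f, h₁, h₂⟩
    rw [mul_smul, ← h₁, ← mul_smul, ρ_smul h₂, W.ρ_r₀]
  · intro h'
    obtain ⟨f, hf, hfg⟩ := exists_smul_r₀_eq (by rw [sign_smul, W.sign_r]) h'
    exact ⟨k * f, by rw [mul_smul, hfg, ← mul_smul, mul_inv_cancel_left], by simpa using hf⟩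

/-- An embedded 4-cycle of types `ĉ, â, ĉ, b̂` has its `â` and `b̂` vertices adjacent. -/
theorem meets_of_square_c {X Z V Y : Set Artin} (hX : IsCosetOf X (Ahat c))
    (hZ : IsCosetOf Z (Ahat c)) (hV : IsCosetOf V (Ahat a)) (hY : IsCosetOf Y (Ahat b))
    (hXZ : X ≠ Z) (hXV : (X ∩ V).Nonempty) (hZV : (Z ∩ V).Nonempty) (hXY : (X ∩ Y).Nonempty)
    (hZY : (Z ∩ Y).Nonempty) : (V ∩ Y).Nonempty := by
  obtain ⟨x, rfl⟩ := hX
  obtain ⟨z, rfl⟩ := hZ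
  obtain ⟨v, rfl⟩ := hV
  obtain ⟨k, rfl⟩ := hY
  rw [meets_c_b_iff] at hXY hZY
  rw [meets_c_a_iff k] at hXV hZV
  rw [Ne, smul_Ahat_c_eq_iff k] at hXZ
  rw [meets_a_b_iff]
  exact ρ_eq_of_inv_mul_mem_T hXY hZY hXZ hXV hZV

/-- An embedded 4-cycle of types `â, ĉ, â, b̂` has its `ĉ` and `b̂` vertices adjacent. -/
theorem meets_of_square_a {X Z V Y : Set Artin} (hX : IsCosetOf X (Ahat a))
    (hZ : IsCosetOf Z (Ahat a)) (hV : IsCosetOf V (Ahat c)) (hY : IsCosetOf Y (Ahat b))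
    (hXZ : X ≠ Z) (hXV : (X ∩ V).Nonempty) (hZV : (Z ∩ V).Nonempty) (hXY : (X ∩ Y).Nonempty)
    (hZY : (Z ∩ Y).Nonempty) : (V ∩ Y).Nonempty := by
  obtain ⟨x, rfl⟩ := hX
  obtain ⟨z, rfl⟩ := hZ
  obtain ⟨v, rfl⟩ := hV
  obtain ⟨k, rfl⟩ := hY
  rw [meets_a_b_iff] at hXY hZY
  rw [Set.inter_comm, meets_c_a_iff k, inv_mul_mem_T_comm] at hXV hZV
  rw [Ne, smul_Ahat_a_eq_iff k] at hXZ
  rw [meets_c_b_iff]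
  exact ρ_eq_of_inv_mul_mem_T hXY hZY hXZ hXV hZV

/-- The cyclic rotation `a ↦ b ↦ c ↦ a` of the generators. -/
def rotateGen : Gen → Gen
  | a => b
  | b => c
  | c => a
  | d => d

/-- The rotation `a ↦ b ↦ c ↦ a` of the `D₄` Artin group, as an endomorphism. -/
def rotateHom : Artin →* Artin :=
  Artin.lift
    (fun
      | a => gen b
      | b => gen c
      | c => gen a
      | d => gen d)
    (Artin.braid (by simp)) (Artin.braid (by simp)) (Artin.braid (by simp))
    (Artin.comm (by simp) (by simp)) (Artin.comm (by simp) (by simp))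
    (Artin.comm (by simp) (by simp))

/-- The rotation `a ↦ b ↦ c ↦ a` of the `D₄` Artin group. -/
def rotate : Artin ≃* Artin :=
  MonoidHom.toMulEquiv rotateHom (rotateHom.comp rotateHom)
    (Artin.hom_ext fun s => by cases s <;> simp [rotateHom])
    (Artin.hom_ext fun s => by cases s <;> simp [rotateHom])

theorem rotate_gen (s : Gen) : rotate (gen s) = gen (rotateGen s) := by
  change rotateHom (gen s) = _
  cases s <;> simp [rotateHom, rotateGen]

theorem map_rotate_Ahat (s : Gen) :
    (Ahat s).map rotate.toMonoidHom = Ahat (rotateGen s) := by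
  rw [Ahat, MonoidHom.map_closure, Ahat]
  congr 1
  ext x
  constructor
  · rintro ⟨_, ⟨t, ht, rfl⟩, rfl⟩
    exact ⟨rotateGen t, by cases s <;> cases t <;> simp_all [rotateGen], rotate_gen t⟩
  · rintro ⟨t, ht, rfl⟩
    refine ⟨gen (rotateGen (rotateGen t)), ⟨_, ?_, rfl⟩, (rotate_gen _).trans ?_⟩
    all_goals cases t <;> cases s <;> simp_all [rotateGen]

theorem IsCosetOf.rotate {X : Set Artin} {s : Gen} (h : IsCosetOf X (Ahat s)) :
    IsCosetOf (rotate '' X) (Ahat (rotateGen s)) := by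
  obtain ⟨g, rfl⟩ := h
  refine ⟨D4Artin.rotate g, ?_⟩
  rw [← map_rotate_Ahat, Set.image_smul_distrib, Subgroup.coe_map]
  rfl

theorem nonempty_rotate_inter {X Y : Set Artin} :
    (rotate '' X ∩ rotate '' Y).Nonempty ↔ (X ∩ Y).Nonempty := by
  rw [← Set.image_inter rotate.injective, Set.image_nonempty]

/-- An embedded 4-cycle of types `b̂, ĉ, b̂, â` has its `ĉ` and `â` vertices adjacent. -/
theorem meets_of_square_b {X Z V Y : Set Artin} (hX : IsCosetOf X (Ahat b))
    (hZ : IsCosetOf Z (Ahat b)) (hV : IsCosetOf V (Ahat c)) (hY : IsCosetOf Y (Ahat a))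
    (hXZ : X ≠ Z) (hXV : (X ∩ V).Nonempty) (hZV : (Z ∩ V).Nonempty) (hXY : (X ∩ Y).Nonempty)
    (hZY : (Z ∩ Y).Nonempty) : (V ∩ Y).Nonempty := by
  rw [← nonempty_rotate_inter] at *
  exact meets_of_square_c hX.rotate hZ.rotate hV.rotate hY.rotate
    (fun h => hXZ (rotate.injective.image_injective h)) hXV hZV hXY hZY

/-- The path `x1, x2, x3, x4` of a 5-cycle retracts to the link of `x0`, unless its ends become
adjacent. -/
theorem exists_path_in_link {x0 x1 x2 x3 x4 : Set Artin} (h0 : IsCosetOf x0 (Ahat b))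
    (h1 : IsCosetOf x1 (Ahat a)) (h3 : IsCosetOf x3 (Ahat a)) (h2 : IsCosetOf x2 (Ahat c))
    (h4 : IsCosetOf x4 (Ahat c)) (e01 : (x0 ∩ x1).Nonempty) (e12 : (x1 ∩ x2).Nonempty)
    (e23 : (x2 ∩ x3).Nonempty) (e34 : (x3 ∩ x4).Nonempty) (e40 : (x4 ∩ x0).Nonempty) :
    (x4 ∩ x1).Nonempty ∨ ∃ y v, IsCosetOf y (Ahat a) ∧ IsCosetOf v (Ahat c) ∧
      (y ∩ x0).Nonempty ∧ (v ∩ x0).Nonempty ∧ (v ∩ x1).Nonempty ∧ (v ∩ y).Nonempty ∧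
        (x4 ∩ y).Nonempty := by
  obtain ⟨k, rfl⟩ := h0
  obtain ⟨g₁, rfl⟩ := h1
  obtain ⟨g₂, rfl⟩ := h2
  obtain ⟨g₃, rfl⟩ := h3
  obtain ⟨g₄, rfl⟩ := h4
  rw [Set.inter_comm, meets_a_b_iff] at e01
  rw [meets_c_b_iff] at e40
  rw [Set.inter_comm, meets_c_a_iff k, inv_mul_mem_T_comm] at e12
  rw [meets_c_a_iff k] at e23
  rw [Set.inter_comm, meets_c_a_iff k, inv_mul_mem_T_comm] at e34
  rcases retract_path e01 e40 e12 e23 e34 with h | ⟨h₁, h₂, h₃⟩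
  · left
    rwa [meets_c_a_iff k, inv_mul_mem_T_comm]
  right
  set w₂ := W.ρ ((k⁻¹ * g₂) • (1 : W)) with hw₂
  set w₃ := W.ρ ((k⁻¹ * g₃) • W.r 0) with hw₃
  have s₁ : W.sign ((k⁻¹ * g₁) • W.r 0) = -1 := by rw [sign_smul, W.sign_r]
  have s₂ : W.sign w₂ = 1 := by
    have := sign_of_mem_T h₁
    rwa [map_mul, map_inv, s₁, inv_neg, inv_one, neg_one_mul, neg_inj] at this
  have s₃ : W.sign w₃ = -1 := by
    have := sign_of_mem_T h₂
    rwa [map_mul, map_inv, s₂, inv_one, one_mul] at this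
  obtain ⟨v, -, hv⟩ := exists_smul_one_eq s₂ (W.ρ_ρ _)
  obtain ⟨y, -, hy⟩ := exists_smul_r₀_eq s₃ (W.ρ_ρ _)
  refine ⟨_, _, ⟨k * y, rfl⟩, ⟨k * v, rfl⟩, ?_, ?_, ?_, ?_, ?_⟩
  · rw [meets_a_b_iff, inv_mul_cancel_left, hy, W.ρ_ρ]
  · rw [meets_c_b_iff, inv_mul_cancel_left, hv, W.ρ_ρ]
  · rwa [meets_c_a_iff k, inv_mul_cancel_left, hv, inv_mul_mem_T_comm]
  · rwa [meets_c_a_iff k, inv_mul_cancel_left, inv_mul_cancel_left, hv, hy]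
  · rwa [meets_c_a_iff k, inv_mul_cancel_left, hy, inv_mul_mem_T_comm]

end D4Artin

open D4Artin D4Artin.Gen

/-- Assume every type I 6-cycle in the `D₄` Artin complex satisfies property `(*)`. Then for
every embedded 5-cycle `x 0, x 1, x 2, x 3, x 4` with `x 0` of type `b̂`, `x 1, x 3` of type
`â` and `x 2, x 4` of type `ĉ`, either `x 4` and `x 1` are adjacent, or `x 0` is adjacent to
each of `x 1, x 2, x 3, x 4`. -/
theorem five_cycle_filling
    (hI : ∀ x : Fin 6 → Set Artin, TypeI x → Star x)
    (x0 x1 x2 x3 x4 : Set Artin)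
    (h0 : IsCosetOf x0 (Ahat b))
    (h1 : IsCosetOf x1 (Ahat a)) (h3 : IsCosetOf x3 (Ahat a))
    (h2 : IsCosetOf x2 (Ahat c)) (h4 : IsCosetOf x4 (Ahat c))
    (h13 : x1 ≠ x3) (h24 : x2 ≠ x4)
    (e01 : (x0 ∩ x1).Nonempty) (e12 : (x1 ∩ x2).Nonempty) (e23 : (x2 ∩ x3).Nonempty)
    (e34 : (x3 ∩ x4).Nonempty) (e40 : (x4 ∩ x0).Nonempty) :
    (x4 ∩ x1).Nonempty ∨ ((x0 ∩ x2).Nonempty ∧ (x0 ∩ x3).Nonempty) := by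
  have hx2 : (x0 ∩ x2).Nonempty → (x0 ∩ x2).Nonempty ∧ (x0 ∩ x3).Nonempty := fun h02 => by
    refine ⟨h02, ?_⟩
    rw [Set.inter_comm] at h02 e34 ⊢
    exact meets_of_square_c h2 h4 h3 h0 h24 e23 e34 h02 e40
  have hx3 : (x0 ∩ x3).Nonempty → (x0 ∩ x2).Nonempty ∧ (x0 ∩ x3).Nonempty := fun h03 => by
    refine ⟨?_, h03⟩
    rw [Set.inter_comm] at h03 e23 e01 ⊢
    exact meets_of_square_a h1 h3 h2 h0 h13 e12 e23 e01 h03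
  rcases exists_path_in_link h0 h1 h3 h2 h4 e01 e12 e23 e34 e40 with
    h | ⟨y, v, hy, hv, ey0, ev0, ev1, evy, e4y⟩
  · exact Or.inl h
  by_cases hv4 : v = x4
  · exact Or.inl (hv4 ▸ ev1)
  by_cases hy1 : y = x1
  · exact Or.inl (hy1 ▸ e4y)
  by_cases hv2 : v = x2
  · exact Or.inr (hx2 (by rwa [Set.inter_comm, ← hv2]))
  by_cases hy3 : y = x3
  · exact Or.inr (hx3 (by rwa [Set.inter_comm, ← hy3]))
  obtain ⟨z, hz, ez2, ez4, ezv⟩ := hI ![x1, x2, x3, x4, y, v]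
    ⟨h1, h3, hy, h2, h4, hv, h13, Ne.symm hy1, Ne.symm hy3, h24, Ne.symm hv2, Ne.symm hv4, by
      rw [Set.inter_comm] at evy
      simpa [Fin.forall_fin_succ] using ⟨e12, e23, e34, e4y, evy, ev1⟩⟩
  simp only [Matrix.cons_val] at ez2 ez4 ezv
  rcases hz with hz | hz
  · by_cases hz1 : z = x1
    · exact Or.inl (by rwa [Set.inter_comm, ← hz1])
    have ez0 : (z ∩ x0).Nonempty := by
      rw [Set.inter_comm] at ez4 ezv
      exact meets_of_square_c hv h4 hz h0 hv4 ezv ez4 ev0 e40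
    refine Or.inr (hx2 ?_)
    rw [Set.inter_comm] at e01 ⊢
    exact meets_of_square_a hz h1 h2 h0 hz1 ez2 e12 ez0 e01
  · by_cases hz0 : z = x0
    · exact Or.inr (hx2 (hz0 ▸ ez2))
    have e1z : (x1 ∩ z).Nonempty := by
      rw [Set.inter_comm] at e12 ez2 ezv
      exact meets_of_square_c h2 hv h1 hz (Ne.symm hv2) e12 ev1 ez2 ezv
    rw [Set.inter_comm] at e40 e1z
    exact Or.inl (meets_of_square_b h0 hz h4 h1 (Ne.symm hz0) e40 ez4 e01 e1z)
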